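/- Let q be a prime with q ≡ 3 (mod 8), and let n_q be a squarefree positive integer all of whose prime factors are congruent to 1 modulo 8, such that q is a quadratic residue modulo every prime factor of n_q. Suppose x, y, z, w are pairwise coprime integers with x, z, w odd and positive and y even and nonzero, satisfying n_q·x² + q·y² = z² and n_q·x² − q·y² = w². Then z ≡ ±1 (mod 8) (i.e., the Jacobi symbol (2/z) equals 1) if and only if the number of primes p dividing n_q for which q is not a quartic residue modulo p is even. -/

import Mathlib

/-- If `q * y ^ 2 = z ^ 2` modulo a prime `p ≡ 1 [MOD 8]`, then `q` is a quartic residue exactly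
when `y * z` is a square. -/
theorem isSquare_mul_iff_exists_pow_four {p : ℕ} [Fact p.Prime] (hp : p % 8 = 1)
    {q y z : ZMod p} (hy : y ≠ 0) (h : q * y ^ 2 = z ^ 2) :
    IsSquare (y * z) ↔ ∃ s : ZMod p, s ^ 4 = q := by
  constructor
  · rintro ⟨t, ht⟩
    refine ⟨t / y, ?_⟩
    have h1 : t ^ 4 = q * y ^ 4 := by
      linear_combination -(t * t + y * z) * ht - y ^ 2 * h
    rw [div_pow, h1]
    field_simp
  · rintro ⟨s, rfl⟩
    obtain ⟨i, hi⟩ : IsSquare (-1 : ZMod p) := ZMod.exists_sq_eq_neg_one_iff.2 (by omega)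
    have h1 : (s ^ 2 * y - z) * (s ^ 2 * y + z) = 0 := by linear_combination h
    rcases mul_eq_zero.1 h1 with h1 | h1
    · exact ⟨s * y, by linear_combination -y * h1⟩
    · exact ⟨i * s * y, by linear_combination y * h1 + s ^ 2 * y ^ 2 * hi⟩

open scoped Classical in
/-- The Jacobi symbol of a squarefree modulus counts the primes at which `a` is a nonresidue. -/
theorem jacobiSym_eq_neg_one_pow_card {n : ℕ} (hn : Squarefree n) (a : ℤ)
    (ha : ∀ p ∈ n.primeFactors, (a : ZMod p) ≠ 0) :
    jacobiSym a n = (-1) ^ (n.primeFactors.filter fun p => ¬ IsSquare (a : ZMod p)).card := by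
  have key : ∀ s : Finset ℕ, (∀ p ∈ s, p.Prime ∧ (a : ZMod p) ≠ 0) →
      jacobiSym a (∏ p ∈ s, p) = (-1) ^ (s.filter fun p => ¬ IsSquare (a : ZMod p)).card := by
    intro s
    induction s using Finset.induction_on with
    | empty => simp
    | insert p s hps ih =>
      intro hs
      obtain ⟨hp, hap⟩ := hs p (Finset.mem_insert_self p s)
      have hs' : ∀ r ∈ s, r.Prime ∧ (a : ZMod r) ≠ 0 :=
        fun r hr => hs r (Finset.mem_insert_of_mem hr)
      have : Fact p.Prime := ⟨hp⟩
      have : NeZero p := ⟨hp.ne_zero⟩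
      have : NeZero (∏ r ∈ s, r) :=
        ⟨Finset.prod_ne_zero_iff.2 fun r hr => (hs' r hr).1.ne_zero⟩
      rw [Finset.prod_insert hps, jacobiSym.mul_right, ih hs', Finset.filter_insert,
        ← jacobiSym.legendreSym.to_jacobiSym]
      split_ifs with hsq
      · rw [(legendreSym.eq_one_iff p hap).2 hsq, one_mul]
      · rw [Finset.card_insert_of_notMem (by simp [hps]), pow_succ,
          (legendreSym.eq_neg_one_iff p).2 hsq, mul_comm]
  conv_lhs => rw [← Nat.prod_primeFactors_of_squarefree hn]
  exact key _ fun p hp => ⟨Nat.prime_of_mem_primeFactors hp, ha p hp⟩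

theorem Nat.mod_eight_eq_one_of_prime_factors {n : ℕ} (hn : n ≠ 0)
    (h : ∀ r : ℕ, r.Prime → r ∣ n → r % 8 = 1) : n % 8 = 1 := by
  induction n using Nat.recOnMul with
  | zero => exact absurd rfl hn
  | one => rfl
  | prime p hp => exact h p hp dvd_rfl
  | mul a b iha ihb =>
    rw [Nat.mul_mod, iha (left_ne_zero_of_mul hn) fun r hr hd => h r hr (hd.mul_right b),
      ihb (right_ne_zero_of_mul hn) fun r hr hd => h r hr (hd.mul_left a)]

theorem jacobiSym_eq_of_dvd_mul_sq_sub {a b c d : ℤ} {m : ℕ} (hc : IsCoprime c m)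
    (hd : IsCoprime d m) (h : (m : ℤ) ∣ a * c ^ 2 - b * d ^ 2) :
    jacobiSym a m = jacobiSym b m := by
  have h1 : jacobiSym (a * c ^ 2) m = jacobiSym (b * d ^ 2) m :=
    jacobiSym.mod_left' (Int.emod_eq_emod_iff_emod_sub_eq_zero.2 (Int.emod_eq_zero_of_dvd h))
  rwa [jacobiSym.mul_left, jacobiSym.mul_left,
    jacobiSym.sq_one' (Int.isCoprime_iff_gcd_eq_one.1 hc),
    jacobiSym.sq_one' (Int.isCoprime_iff_gcd_eq_one.1 hd), mul_one, mul_one] at h1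

/-- If `n ≡ 1 [MOD 8]`, then `n` being a square modulo `y` makes the Jacobi symbol `(y / n)`
trivial. -/
theorem jacobiSym_eq_one_of_dvd_mul_sq_sub_sq {n : ℕ} (hn : n % 8 = 1) {x y z : ℤ} (hy : y ≠ 0)
    (hxy : IsCoprime x y) (hzy : IsCoprime z y) (h : y ∣ n * x ^ 2 - z ^ 2) :
    jacobiSym y n = 1 := by
  have hodd : Odd n := Nat.odd_iff.2 (by omega)
  have hneg : jacobiSym (-1) n = 1 := by
    rw [jacobiSym.at_neg_one hodd, ZMod.χ₄_nat_one_mod_four (by omega)]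
  have htwo : jacobiSym 2 n = 1 := by
    rw [jacobiSym.at_two hodd, ZMod.χ₈_nat_eq_if_mod_eight]
    simp [hn]
    omega
  obtain ⟨k, m, hm, hkm⟩ := Nat.exists_eq_two_pow_mul_odd (Int.natAbs_ne_zero.2 hy)
  have hmy : (m : ℤ) ∣ y := Int.natCast_dvd.2 (hkm ▸ Dvd.intro_left _ rfl)
  have hnm : jacobiSym n m = 1 := by
    rw [jacobiSym_eq_of_dvd_mul_sq_sub (b := 1) (hxy.of_isCoprime_of_dvd_right hmy)
      (hzy.of_isCoprime_of_dvd_right hmy) (by simpa using hmy.trans h), jacobiSym.one_left]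
  have habs : jacobiSym (y.natAbs : ℤ) n = 1 := by
    rw [hkm]
    push_cast
    rw [jacobiSym.mul_left, jacobiSym.pow_left, htwo, one_pow, one_mul,
      ← jacobiSym.quadratic_reciprocity_one_mod_four (by omega) hm, hnm]
  rcases Int.natAbs_eq y with hy' | hy' <;> rw [hy']
  · exact habs
  · rw [← neg_one_mul, jacobiSym.mul_left, hneg, habs, one_mul]

theorem jacobiSym_neg_eq_of_three_mod_four {q z : ℕ} (hq : q % 4 = 3) (hz : Odd z) :
    jacobiSym (-q) z = jacobiSym z q := by
  have hq' : Odd q := Nat.odd_iff.2 (by omega)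
  rw [← neg_one_mul, jacobiSym.mul_left, jacobiSym.at_neg_one hz]
  rcases Nat.odd_mod_four_iff.1 (Nat.odd_iff.1 hz) with h | h
  · rw [ZMod.χ₄_nat_one_mod_four h, jacobiSym.quadratic_reciprocity_one_mod_four' hq' h, one_mul]
  · rw [ZMod.χ₄_nat_three_mod_four h, jacobiSym.quadratic_reciprocity_three_mod_four hq h]
    ring

theorem Int.exists_sq_of_isCoprime_of_pos {a b c : ℤ} (h : IsCoprime a b) (ha : 0 < a)
    (heq : a * b = c ^ 2) : ∃ d, a = d ^ 2 := by
  obtain ⟨d, hd | hd⟩ := Int.sq_of_isCoprime h heq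
  · exact ⟨d, hd⟩
  · exact absurd (sq_nonneg d) (by linarith)

theorem exists_sq_add_of_mul_eq {q u v t : ℤ} (hq : Prime q) (hq0 : 0 < q) (hu : 0 < u)
    (hv : 0 < v) (huv : IsCoprime u v) (h : u * v = 2 * q * t ^ 2) :
    ∃ a b : ℤ, u + v = a ^ 2 + 2 * q * b ^ 2 ∨ u + v = 2 * a ^ 2 + q * b ^ 2 := by
  wlog hqv : q ∣ v generalizing u v
  · have hqu : q ∣ u :=
      (hq.dvd_or_dvd (h ▸ (Dvd.intro_left 2 rfl).mul_right _)).resolve_right hqv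
    simpa only [add_comm] using this hv hu huv.symm (by rw [mul_comm, h]) hqu
  obtain ⟨v, rfl⟩ := hqv
  have hv' : 0 < v := pos_of_mul_pos_right hv hq0.le
  have huv' : IsCoprime u v := huv.of_mul_right_right
  have h' : u * v = 2 * t ^ 2 := mul_left_cancel₀ hq.ne_zero (by linear_combination h)
  rcases Int.prime_two.dvd_or_dvd (h' ▸ Dvd.intro _ rfl : (2 : ℤ) ∣ u * v) with ⟨d, rfl⟩ | ⟨d, rfl⟩
  · have hc := huv'.of_mul_left_right
    have he : d * v = t ^ 2 := by linarith
    obtain ⟨a, rfl⟩ := Int.exists_sq_of_isCoprime_of_pos hc (by linarith) he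
    obtain ⟨b, rfl⟩ := Int.exists_sq_of_isCoprime_of_pos hc.symm hv' ((mul_comm _ _).trans he)
    exact ⟨a, b, Or.inr rfl⟩
  · have hc := huv'.of_mul_right_right
    have he : u * d = t ^ 2 := by linarith
    obtain ⟨a, rfl⟩ := Int.exists_sq_of_isCoprime_of_pos hc hu he
    obtain ⟨b, rfl⟩ :=
      Int.exists_sq_of_isCoprime_of_pos hc.symm (by linarith) ((mul_comm _ _).trans he)
    exact ⟨a, b, Or.inl (by ring)⟩

/-- For `z = a ^ 2 + 2 * q * b ^ 2` or `z = 2 * a ^ 2 + q * b ^ 2` odd and prime to `q`, the symbols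
`(z / q)` and `(2 / z)` agree. -/
theorem mod_eight_iff_jacobiSym_eq_one {q : ℕ} (hqmod : q % 8 = 3) {z a b : ℤ}
    (hz : Odd z) (hzq : IsCoprime z q)
    (h : z = a ^ 2 + 2 * q * b ^ 2 ∨ z = 2 * a ^ 2 + q * b ^ 2) :
    (z % 8 = 1 ∨ z % 8 = 7) ↔ jacobiSym z q = 1 := by
  have hsq : ∀ c : ℤ, c ^ 2 % 8 = 0 ∨ c ^ 2 % 8 = 1 ∨ c ^ 2 % 8 = 4 := by
    intro c
    have : c % 8 = 0 ∨ c % 8 = 1 ∨ c % 8 = 2 ∨ c % 8 = 3 ∨ c % 8 = 4 ∨ c % 8 = 5 ∨ c % 8 = 6 ∨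
      c % 8 = 7 := by omega
    rcases this with h | h | h | h | h | h | h | h <;> simp [pow_two, Int.mul_emod, h]
  obtain ⟨k, hk⟩ : ∃ k : ℤ, (q : ℤ) = 8 * k + 3 := ⟨q / 8, by omega⟩
  have hz2 := Int.odd_iff.1 hz
  have hB : (q : ℤ) * b ^ 2 = 8 * (k * b ^ 2) + 3 * b ^ 2 := by rw [hk]; ring
  have ha := hsq a
  have hb := hsq b
  rcases h with h | h
  · have hcop : IsCoprime a q := by
      have : IsCoprime (a ^ 2 + q * (2 * b ^ 2)) (q : ℤ) := by
        convert hzq using 1; rw [h]; ring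
      exact (IsCoprime.pow_left_iff two_pos).1 this.of_add_mul_left_left
    have hJ : jacobiSym z q = 1 := by
      rw [jacobiSym_eq_of_dvd_mul_sq_sub (b := 1) (c := 1) isCoprime_one_left hcop
        ⟨2 * b ^ 2, by rw [h]; ring⟩, jacobiSym.one_left]
    have h8 : z = a ^ 2 + 2 * (q * b ^ 2) := by rw [h]; ring
    simp only [hJ, iff_true]
    omega
  · have hcop : IsCoprime a q := by
      have : IsCoprime (2 * a ^ 2 + q * b ^ 2) (q : ℤ) := h ▸ hzq
      exact (IsCoprime.pow_left_iff two_pos).1 this.of_add_mul_left_left.of_mul_left_right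
    have hJ : jacobiSym z q = -1 := by
      rw [jacobiSym_eq_of_dvd_mul_sq_sub (b := 2) (c := 1) isCoprime_one_left hcop
        ⟨b ^ 2, by rw [h]; ring⟩, jacobiSym.at_two (Nat.odd_iff.2 (by omega)),
        ZMod.χ₈_nat_eq_if_mod_eight]
      simp [hqmod]
      omega
    rw [hJ]
    norm_num
    omega

open scoped Classical in
theorem stmt13 (q : ℕ) (hq : q.Prime) (hqmod : q % 8 = 3)
    (nq : ℕ) (hnq0 : 0 < nq) (hsf : Squarefree nq)
    (hfac : ∀ r : ℕ, r.Prime → r ∣ nq → r % 8 = 1)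
    (hQR : ∀ r : ℕ, r.Prime → r ∣ nq → IsSquare ((q : ZMod r)))
    (x y z w : ℤ)
    (hxy : IsCoprime x y) (hxz : IsCoprime x z) (hxw : IsCoprime x w)
    (hyz : IsCoprime y z) (hyw : IsCoprime y w) (hzw : IsCoprime z w)
    (hx : Odd x) (hx0 : 0 < x) (hz : Odd z) (hz0 : 0 < z) (hw : Odd w) (hw0 : 0 < w)
    (hy : Even y) (hy0 : y ≠ 0)
    (e1 : (nq : ℤ) * x ^ 2 + (q : ℤ) * y ^ 2 = z ^ 2)
    (e2 : (nq : ℤ) * x ^ 2 - (q : ℤ) * y ^ 2 = w ^ 2) :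
    (z % 8 = 1 ∨ z % 8 = 7) ↔
      Even ((nq.primeFactors.filter fun r => ¬ ∃ s : ZMod r, s ^ 4 = (q : ZMod r)).card) := by
  have hn8 : nq % 8 = 1 := Nat.mod_eight_eq_one_of_prime_factors hnq0.ne' hfac
  have hqp : Prime (q : ℤ) := Nat.prime_iff_prime_int.1 hq
  have hq0 : (0 : ℤ) < q := by exact_mod_cast hq.pos
  have hzq : IsCoprime z q := by
    refine ((Prime.coprime_iff_not_dvd hqp).2 fun hd => ?_).symm
    have h1 : (q : ℤ) ∣ nq * x ^ 2 := by
      rw [eq_sub_of_add_eq e1]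
      exact dvd_sub (dvd_pow hd two_ne_zero) (Dvd.intro _ rfl)
    rcases hqp.dvd_or_dvd h1 with h2 | h2
    · have := hfac q hq (Int.natCast_dvd_natCast.1 h2)
      omega
    · exact hqp.not_isUnit (hxz.isUnit_of_dvd' (hqp.dvd_of_dvd_pow h2) hd)
  -- `(z / q) = (2 / z)`
  have hzJ : (z % 8 = 1 ∨ z % 8 = 7) ↔ jacobiSym z q = 1 := by
    obtain ⟨t, rfl⟩ := hy.exists_two_nsmul
    obtain ⟨u, hu⟩ := hz.add_odd hw
    have hv : z - u = u - w := by linarith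
    have hqt : 0 < (q : ℤ) * t ^ 2 := mul_pos hq0 (by
      have : t ≠ 0 := fun h => hy0 (by simp [h])
      positivity)
    simp only [nsmul_eq_mul, Nat.cast_ofNat] at e1 e2
    have huv : u * (z - u) = 2 * q * t ^ 2 := by
      have hw' : w = 2 * u - z := by linarith
      subst hw'
      linarith
    have hu0 : 0 < u := by linarith
    have hv0 : 0 < z - u := pos_of_mul_pos_right (by linarith) hu0.le
    have hcop : IsCoprime u (z - u) := by
      obtain ⟨r, s, hrs⟩ := hzw
      exact ⟨r + s, r - s, by
        have hw' : w = 2 * u - z := by linarith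
        subst hw'
        linear_combination hrs⟩
    obtain ⟨a, b, hab⟩ := exists_sq_add_of_mul_eq hqp hq0 hu0 hv0 hcop huv
    rw [add_sub_cancel] at hab
    exact mod_eight_iff_jacobiSym_eq_one hqmod hz hzq hab
  -- `(z / n) = (n / z) = (-q / z) = (z / q)`
  have hzn : jacobiSym z nq = jacobiSym z q := by
    lift z to ℕ using hz0.le
    have hzo : Odd z := by exact_mod_cast hz
    rw [← jacobiSym.quadratic_reciprocity_one_mod_four (by omega) hzo,
      ← jacobiSym_neg_eq_of_three_mod_four (by omega) hzo]
    exact jacobiSym_eq_of_dvd_mul_sq_sub hxz hyz ⟨z, by linear_combination e1⟩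
  have hyn : jacobiSym y nq = 1 :=
    jacobiSym_eq_one_of_dvd_mul_sq_sub_sq hn8 hy0 hxy hyz.symm
      ⟨-(q * y), by linear_combination e1⟩
  have hlocal : ∀ p ∈ nq.primeFactors, (y : ZMod p) ≠ 0 ∧ (z : ZMod p) ≠ 0 ∧
      (IsSquare ((y * z : ℤ) : ZMod p) ↔ ∃ s : ZMod p, s ^ 4 = (q : ZMod p)) := by
    intro p hp
    have hpp := Nat.prime_of_mem_primeFactors hp
    have hpn := Nat.dvd_of_mem_primeFactors hp
    have : Fact p.Prime := ⟨hpp⟩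
    have hn : (nq : ZMod p) = 0 := (ZMod.natCast_eq_zero_iff _ _).2 hpn
    have he : (q : ZMod p) * (y : ZMod p) ^ 2 = (z : ZMod p) ^ 2 := by
      have := congrArg (Int.cast : ℤ → ZMod p) e1
      push_cast at this
      simpa [hn] using this
    have hc : ¬ ((y : ZMod p) = 0 ∧ (z : ZMod p) = 0) := by
      rintro ⟨h1, h2⟩
      rw [ZMod.intCast_zmod_eq_zero_iff_dvd] at h1 h2
      exact (Nat.prime_iff_prime_int.1 hpp).not_isUnit (hyz.isUnit_of_dvd' h1 h2)
    have hqp0 : (q : ZMod p) ≠ 0 := by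
      intro h
      rw [ZMod.natCast_eq_zero_iff, Nat.prime_dvd_prime_iff_eq hpp hq] at h
      have := hfac p hpp hpn
      omega
    have hy1 : (y : ZMod p) ≠ 0 := fun h => hc ⟨h, by simpa [h] using he.symm⟩
    refine ⟨hy1, fun h => ?_, ?_⟩
    · rw [h, zero_pow two_ne_zero] at he
      exact mul_ne_zero hqp0 (pow_ne_zero 2 hy1) he
    · rw [Int.cast_mul]
      exact isSquare_mul_iff_exists_pow_four (hfac p hpp hpn) hy1 he
  have hcard := jacobiSym_eq_neg_one_pow_card hsf (y * z) (fun p hp => by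
    have : Fact p.Prime := ⟨Nat.prime_of_mem_primeFactors hp⟩
    rw [Int.cast_mul]
    exact mul_ne_zero (hlocal p hp).1 (hlocal p hp).2.1)
  rw [jacobiSym.mul_left, hyn, one_mul, hzn,
    Finset.filter_congr fun p hp => not_congr (hlocal p hp).2.2] at hcard
  rw [hzJ, hcard, neg_one_pow_eq_one_iff_even (by norm_num)]
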